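/- Let E be a locally compact Polish space and Q a jointly weakly continuous transition function. Then for every n ≥ 0 and every bounded continuous F : E → ℝ, the function (s,t,x) ↦ U⁽ⁿ⁾(s,t)F(x) := ∫_E F(y) P⁽ⁿ⁾(s,x;t,dy) is continuous on {(s,t) : 0 ≤ s ≤ t} × E. -/

import Mathlib

open MeasureTheory Set

variable {E : Type*}

/-- The cumulative intensity `q(t,x) = Q(t,x,E)`. -/
noncomputable def qIntensity [MeasurableSpace E] (Q : ℝ → E → Measure E) (t : ℝ) (x : E) : ℝ :=
  (Q t x univ).toReal

/-- The iterated kernels `P⁽ⁿ⁾(s,x;t,·)`. -/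
noncomputable def Piter [MeasurableSpace E] (Q : ℝ → E → Measure E) :
    ℕ → ℝ → ℝ → E → Measure E
  | 0, s, t, x =>
      ENNReal.ofReal (Real.exp (-∫ r in s..t, qIntensity Q r x)) • Measure.dirac x
  | n + 1, s, t, x =>
      Measure.bind
        ((volume.restrict (Ioc s t)).withDensity fun r =>
          ENNReal.ofReal (Real.exp (-∫ τ in s..r, qIntensity Q τ x)))
        fun r => Measure.bind (Q r x) fun y => Piter Q n r t y

/-- The minimal transition function `P(s,x;t,·) = Σ_n P⁽ⁿ⁾(s,x;t,·)`. -/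
noncomputable def Pmin [MeasurableSpace E] (Q : ℝ → E → Measure E) (s t : ℝ) (x : E) :
    Measure E :=
  Measure.sum fun n => Piter Q n s t x

/-- The evolution system `U(s,t)F(x) = ∫_E F(y) P(s,x;t,dy)`. -/
noncomputable def Umin [MeasurableSpace E] (Q : ℝ → E → Measure E) (s t : ℝ) (F : E → ℝ)
    (x : E) : ℝ :=
  ∫ y, F y ∂(Pmin Q s t x)

/-- `Q` is a transition function. -/
def IsTransitionFunction [MeasurableSpace E] [TopologicalSpace E]
    (Q : ℝ → E → Measure E) : Prop :=
  (∀ t x, 0 ≤ t → IsFiniteMeasure (Q t x)) ∧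
  (∀ t x, 0 ≤ t → Q t x {x} = 0) ∧
  (∀ A : Set E, MeasurableSet A → Measurable fun p : ℝ × E => Q p.1 p.2 A) ∧
  (∀ T > (0 : ℝ), ∀ B : Set E, IsCompact B →
    ∃ C : ℝ, ∀ t ∈ Icc (0 : ℝ) T, ∀ x ∈ B, (Q t x univ).toReal ≤ C)

/-- The standing hypotheses (H). -/
structure StandingHypotheses [MeasurableSpace E] [TopologicalSpace E]
    (Q : ℝ → E → Measure E) (V : E → ℝ) (c : ℝ → ℝ) : Prop where
  V_cont : Continuous V
  V_nonneg : ∀ x, 0 ≤ V x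
  c_cont : Continuous c
  c_nonneg : ∀ t, 0 ≤ c t
  weak_cont : ∀ F : E → ℝ, Continuous F → (∃ M : ℝ, ∀ x, |F x| ≤ M * (1 + V x)) →
    ContinuousOn (fun p : ℝ × E => ∫ y, F y ∂(Q p.1 p.2)) {p : ℝ × E | 0 ≤ p.1}
  q_bound : ∀ T > (0 : ℝ), ∃ a > (0 : ℝ), ∀ t ∈ Icc (0 : ℝ) T, ∀ x,
    qIntensity Q t x ≤ a * V x
  lyapunov : ∀ t : ℝ, 0 ≤ t → ∀ x,
    ∫⁻ y, ENNReal.ofReal (V y) ∂(Q t x)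
      ≤ ENNReal.ofReal (c t * V x + qIntensity Q t x * V x)
  localization : ∀ ε > (0 : ℝ), ∀ B : Set E, IsCompact B → ∀ T > (0 : ℝ),
    ∃ A : Set E, IsCompact A ∧ ∀ x ∈ B, ∫ r in (0 : ℝ)..T, (Q r x Aᶜ).toReal < ε

/-- `Q` is jointly weakly continuous: `(t,x) ↦ ∫_E F(y) Q(t,x,dy)` is continuous for
every bounded continuous `F`. -/
def JointlyWeaklyContinuous [MeasurableSpace E] [TopologicalSpace E]
    (Q : ℝ → E → Measure E) : Prop :=
  ∀ F : E → ℝ, Continuous F → (∃ M : ℝ, ∀ x, |F x| ≤ M) →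
    ContinuousOn (fun p : ℝ × E => ∫ y, F y ∂(Q p.1 p.2)) {p : ℝ × E | 0 ≤ p.1}

open Filter Topology
open scoped ENNReal NNReal

/-- A family of finite measures depending continuously on its parameter in the weak topology. -/
def WeaklyContinuous {X E : Type*} [TopologicalSpace X] [MeasurableSpace E] [TopologicalSpace E]
    (μ : X → Measure E) : Prop :=
  (∀ x, IsFiniteMeasure (μ x)) ∧
  ∀ F : E → ℝ, Continuous F → (∃ M : ℝ, ∀ y, |F y| ≤ M) → Continuous fun x => ∫ y, F y ∂(μ x)

theorem integrable_of_continuous_of_abs_le [MeasurableSpace E] [TopologicalSpace E]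
    [OpensMeasurableSpace E] {μ : Measure E} [IsFiniteMeasure μ] {F : E → ℝ} (hF : Continuous F)
    (hM : ∃ M : ℝ, ∀ y, |F y| ≤ M) : Integrable F μ := by
  obtain ⟨M, hM⟩ := hM
  exact .of_bound hF.measurable.aestronglyMeasurable M (.of_forall hM)

theorem integral_bind {α β : Type*} [MeasurableSpace α] [MeasurableSpace β] {μ : Measure α}
    {κ : α → Measure β} (hκ : AEMeasurable κ μ) {F : β → ℝ} (hF : Measurable F)
    (hint : Integrable F (μ.bind κ)) :
    ∫ y, F y ∂(μ.bind κ) = ∫ a, ∫ y, F y ∂(κ a) ∂μ := by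
  have hpos : Measurable fun y => ENNReal.ofReal (F y) := hF.ennreal_ofReal
  have hneg : Measurable fun y => ENNReal.ofReal (-F y) := hF.neg.ennreal_ofReal
  have hmeas {f : β → ℝ≥0∞} (hf : Measurable f) : AEMeasurable (fun a => ∫⁻ y, f y ∂(κ a)) μ :=
    (Measure.measurable_lintegral hf).comp_aemeasurable hκ
  have hposfin : ∫⁻ a, ∫⁻ y, ENNReal.ofReal (F y) ∂(κ a) ∂μ ≠ ∞ := by
    rw [← Measure.lintegral_bind hκ hpos.aemeasurable]
    exact hint.lintegral_lt_top.ne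
  have hnegfin : ∫⁻ a, ∫⁻ y, ENNReal.ofReal (-F y) ∂(κ a) ∂μ ≠ ∞ := by
    rw [← Measure.lintegral_bind hκ hneg.aemeasurable]
    exact hint.neg.lintegral_lt_top.ne
  have hposae := ae_lt_top' (hmeas hpos) hposfin
  have hnegae := ae_lt_top' (hmeas hneg) hnegfin
  have hinner : ∀ᵐ a ∂μ, ∫ y, F y ∂(κ a) =
      (∫⁻ y, ENNReal.ofReal (F y) ∂(κ a)).toReal -
        (∫⁻ y, ENNReal.ofReal (-F y) ∂(κ a)).toReal := by
    filter_upwards [hposae, hnegae] with a ha ha'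
    refine integral_eq_lintegral_pos_part_sub_lintegral_neg_part
      ⟨hF.aestronglyMeasurable, ?_⟩
    rw [hasFiniteIntegral_iff_norm]
    calc ∫⁻ y, ENNReal.ofReal ‖F y‖ ∂(κ a)
        ≤ ∫⁻ y, (ENNReal.ofReal (F y) + ENNReal.ofReal (-F y)) ∂(κ a) := by
          refine lintegral_mono fun y => ?_
          rcases le_total 0 (F y) with h | h
          · rw [Real.norm_of_nonneg h]; exact le_self_add
          · rw [Real.norm_of_nonpos h]; exact le_add_self
      _ = _ := lintegral_add_left hpos _
      _ < ∞ := ENNReal.add_lt_top.2 ⟨ha, ha'⟩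
  rw [integral_congr_ae hinner, integral_sub
      (integrable_toReal_of_lintegral_ne_top (hmeas hpos) hposfin)
      (integrable_toReal_of_lintegral_ne_top (hmeas hneg) hnegfin),
    integral_toReal (hmeas hpos) hposae, integral_toReal (hmeas hneg) hnegae,
    integral_eq_lintegral_pos_part_sub_lintegral_neg_part hint,
    Measure.lintegral_bind hκ hpos.aemeasurable, Measure.lintegral_bind hκ hneg.aemeasurable]

namespace WeaklyContinuous

variable {X Y : Type*} [TopologicalSpace X] [TopologicalSpace Y] [MeasurableSpace E]
  [TopologicalSpace E]

theorem comp {μ : X → Measure E} (hμ : WeaklyContinuous μ) {g : Y → X} (hg : Continuous g) :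
    WeaklyContinuous fun y => μ (g y) :=
  ⟨fun y => hμ.1 (g y), fun F hF hM => (hμ.2 F hF hM).comp hg⟩

theorem measurable [BorelSpace E] [HasOuterApproxClosed E] [MeasurableSpace X]
    [OpensMeasurableSpace X] {μ : X → Measure E} (hμ : WeaklyContinuous μ) : Measurable μ := by
  have := hμ.1
  have hclosed (C : Set E) (hC : IsClosed C) : Measurable fun x => μ x C := by
    refine measurable_of_tendsto_metrizable (f := fun n x => ∫⁻ y, hC.apprSeq n y ∂(μ x)) ?_
      (tendsto_pi_nhds.2 fun x => HasOuterApproxClosed.tendsto_lintegral_apprSeq hC (μ x))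
    intro n
    have hcont : Continuous fun y => (hC.apprSeq n y : ℝ) := by fun_prop
    have hbdd : ∃ M : ℝ, ∀ y, |(hC.apprSeq n y : ℝ)| ≤ M := by
      refine ⟨1, fun y => ?_⟩
      rw [abs_of_nonneg NNReal.zero_le_coe]
      exact_mod_cast HasOuterApproxClosed.apprSeq_apply_le_one hC n y
    convert (hμ.2 _ hcont hbdd).measurable.ennreal_ofReal with x
    rw [ofReal_integral_eq_lintegral_ofReal (integrable_of_continuous_of_abs_le hcont hbdd)
      (.of_forall fun y => NNReal.zero_le_coe)]
    simp
  exact .measure_of_isPiSystem (BorelSpace.measurable_eq.trans borel_eq_generateFrom_isClosed)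
    isPiSystem_isClosed hclosed (hclosed univ isClosed_univ)

theorem continuous_integral [BorelSpace E] [PolishSpace E] [LocallyCompactSpace E]
    {μ : X → Measure E} (hμ : WeaklyContinuous μ) {h : X → E → ℝ}
    (hh : Continuous (Function.uncurry h)) {M : ℝ} (hM : ∀ x y, |h x y| ≤ M) :
    Continuous fun x => ∫ y, h x y ∂(μ x) := by
  have := hμ.1
  let _ := TopologicalSpace.upgradeIsCompletelyMetrizable E
  have hhx (x : X) : Continuous (h x) := hh.comp (.prodMk_right x)
  refine continuous_iff_continuousAt.2 fun x₀ => Metric.tendsto_nhds.2 fun ε hε => ?_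
  rcases isEmpty_or_nonempty E with hE | ⟨⟨y₀⟩⟩
  · simp [Measure.eq_zero_of_isEmpty, hε]
  have hM0 : 0 ≤ M := (abs_nonneg _).trans (hM x₀ y₀)
  set m := (μ x₀).real univ
  have hm : 0 ≤ m := measureReal_nonneg
  obtain ⟨δ, hδ, hδε⟩ : ∃ δ > 0, δ * m + 2 * M * δ < ε := by
    refine ⟨ε / (m + 2 * M + 1), by positivity, ?_⟩
    rw [div_mul_eq_mul_div, mul_div_assoc', ← add_div, div_lt_iff₀ (by positivity)]
    nlinarith
  obtain ⟨K, -, hK, -, hKδ⟩ := MeasurableSet.univ.exists_isCompact_isClosed_sdiff_lt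
    (measure_ne_top (μ x₀) univ) (ε := ENNReal.ofReal δ) (by simpa using hδ)
  obtain ⟨φ, hφK, -, hφc, hφ⟩ :=
    exists_continuous_one_zero_of_isCompact hK isClosed_empty (disjoint_empty K)
  set b : E → ℝ := fun y => δ + 2 * M * (1 - φ y) with hb
  have hbcont : Continuous b := by fun_prop
  have hbbdd : ∃ B : ℝ, ∀ y, |b y| ≤ B := by
    refine ⟨δ + 2 * M, fun y => ?_⟩
    obtain ⟨h0, h1⟩ := hφ y
    have : 0 ≤ M * φ y := by positivity
    have : 0 ≤ M * (1 - φ y) := mul_nonneg hM0 (by linarith)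
    rw [abs_le]
    constructor <;> simp only [hb] <;> nlinarith
  have hclose : ∀ᶠ x in 𝓝 x₀, ∀ y ∈ tsupport φ, |h x y - h x₀ y| < δ := by
    refine hφc.isCompact.eventually_forall_of_forall_eventually fun y _ => ?_
    have hc : Continuous fun z : X × E => |h z.1 z.2 - h x₀ z.2| :=
      (hh.sub ((hhx x₀).comp continuous_snd)).abs
    exact hc.continuousAt.eventually_lt continuousAt_const (by simpa using hδ)
  have hbint : ∫ y, b y ∂(μ x₀) < ε := by
    refine lt_of_le_of_lt ?_ hδε
    have h1 : ∫ y, b y ∂(μ x₀) = δ * m + 2 * M * ∫ y, (1 - φ y) ∂(μ x₀) := by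
      have : Integrable (fun y => 2 * M * (1 - φ y)) (μ x₀) :=
        (integrable_of_continuous_of_abs_le (by fun_prop) ⟨1, fun y => by
          obtain ⟨h0, h1⟩ := hφ y
          rw [abs_le]; constructor <;> linarith⟩).const_mul _
      rw [hb, integral_add (integrable_const _) this, integral_const_mul]
      simp [m, mul_comm]
    have h2 : ∫ y, (1 - φ y) ∂(μ x₀) ≤ δ := by
      refine (ENNReal.ofReal_le_ofReal_iff hδ.le).1 ((integral_le_measure (s := univ \ K)
        (fun y _ => ?_) (fun y hy => ?_)).trans hKδ.le)
      · linarith [(hφ y).1]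
      · have : φ y = 1 := hφK (by simpa using hy)
        simp [this]
    rw [h1]
    gcongr
  have hev : ∀ᶠ x in 𝓝 x₀,
      ∫ y, b y ∂(μ x) + |∫ y, h x₀ y ∂(μ x) - ∫ y, h x₀ y ∂(μ x₀)| < ε := by
    refine ContinuousAt.eventually_lt (Continuous.continuousAt ?_) continuousAt_const
      (by simpa using hbint)
    exact (hμ.2 b hbcont hbbdd).add ((hμ.2 _ (hhx x₀) ⟨M, hM x₀⟩).sub continuous_const).abs
  filter_upwards [hclose, hev] with x hx hx'
  have hi (x' : X) : Integrable (h x') (μ x) :=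
    integrable_of_continuous_of_abs_le (hhx x') ⟨M, hM x'⟩
  have hle : |∫ y, h x y ∂(μ x) - ∫ y, h x₀ y ∂(μ x)| ≤ ∫ y, b y ∂(μ x) := by
    rw [← integral_sub (hi x) (hi x₀)]
    refine (abs_integral_le_integral_abs).trans (integral_mono ((hi x).sub (hi x₀)).abs
      (integrable_of_continuous_of_abs_le hbcont hbbdd) fun y => ?_)
    obtain ⟨h0, h1⟩ := hφ y
    by_cases hy : y ∈ tsupport φ
    · have : 0 ≤ 2 * M * (1 - φ y) := mul_nonneg (by positivity) (by linarith)
      have := (hx y hy).le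
      simp only [hb]
      linarith
    · have := abs_sub (h x y) (h x₀ y)
      have := hM x y
      have := hM x₀ y
      simp only [hb, image_eq_zero_of_notMem_tsupport hy]
      linarith
  rw [Real.dist_eq]
  calc |∫ y, h x y ∂(μ x) - ∫ y, h x₀ y ∂(μ x₀)|
      ≤ |∫ y, h x y ∂(μ x) - ∫ y, h x₀ y ∂(μ x)|
        + |∫ y, h x₀ y ∂(μ x) - ∫ y, h x₀ y ∂(μ x₀)| := abs_sub_le _ _ _
    _ < ε := by linarith

theorem bind [BorelSpace E] [PolishSpace E] [LocallyCompactSpace E] {μ : X → Measure E}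
    (hμ : WeaklyContinuous μ) {κ : X → E → Measure E}
    (hκ : WeaklyContinuous (Function.uncurry κ)) (hκ1 : ∀ x y, κ x y univ ≤ 1) :
    WeaklyContinuous fun x => (μ x).bind (κ x) := by
  have := hμ.1
  let _ := TopologicalSpace.upgradeIsCompletelyMetrizable E
  have hfin (x : X) : IsFiniteMeasure ((μ x).bind (κ x)) := by
    refine ⟨(Measure.bind_apply_le (κ x) .univ).trans_lt ?_⟩
    exact (lintegral_mono (hκ1 x)).trans_lt (by simp)
  refine ⟨hfin, fun F hF hM => ?_⟩
  obtain ⟨M, hM⟩ := hM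
  have hbound (x : X) (y : E) : |∫ z, F z ∂(κ x y)| ≤ |M| := by
    have : IsFiniteMeasure (κ x y) := hκ.1 (x, y)
    refine (norm_integral_le_of_norm_le_const (f := F) (C := |M|)
      (.of_forall fun z => (hM z).trans (le_abs_self M))).trans ?_
    exact mul_le_of_le_one_right (abs_nonneg M) (ENNReal.toReal_mono ENNReal.one_ne_top (hκ1 x y))
  have hmeas (x : X) : Measurable (κ x) := (hκ.comp (Continuous.prodMk_right x)).measurable
  simp_rw [fun x => integral_bind (hmeas x).aemeasurable hF.measurable
    (integrable_of_continuous_of_abs_le (μ := (μ x).bind (κ x)) hF ⟨M, hM⟩)]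
  exact hμ.continuous_integral (hκ.2 F hF ⟨M, hM⟩) hbound

end WeaklyContinuous

theorem Continuous.intervalIntegral_parametric {X : Type*} [TopologicalSpace X] {f : X → ℝ → ℝ}
    (hf : Continuous (Function.uncurry f)) {a b : X → ℝ} (ha : Continuous a) (hb : Continuous b) :
    Continuous fun x => ∫ r in (a x)..(b x), f x r := by
  have hfx (x : X) (c d : ℝ) : IntervalIntegrable (f x) volume c d :=
    (hf.comp (.prodMk_right x)).intervalIntegrable c d
  simp_rw [fun x => (intervalIntegral.integral_interval_sub_left (hfx x 0 (b x))
    (hfx x 0 (a x))).symm]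
  exact (intervalIntegral.continuous_parametric_intervalIntegral_of_continuous hf hb).sub
    (intervalIntegral.continuous_parametric_intervalIntegral_of_continuous hf ha)

theorem integral_exp_neg_integral_mul {q : ℝ → ℝ} (hq : Continuous q) (s t : ℝ) :
    ∫ r in s..t, Real.exp (-∫ τ in s..r, q τ) * q r = 1 - Real.exp (-∫ τ in s..t, q τ) := by
  have hd (r : ℝ) : HasDerivAt (fun r => -Real.exp (-∫ τ in s..r, q τ))
      (Real.exp (-∫ τ in s..r, q τ) * q r) r := by
    refine (hq.integral_hasStrictDerivAt s r).hasDerivAt.neg.exp.neg.congr_deriv ?_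
    simp only [Pi.neg_apply, mul_neg, neg_neg]
  have hc : Continuous fun r => Real.exp (-∫ τ in s..r, q τ) * q r :=
    (Real.continuous_exp.comp (intervalIntegral.continuous_primitive
      (fun a b => hq.intervalIntegrable a b) s).neg).mul hq
  rw [intervalIntegral.integral_eq_sub_of_hasDerivAt (fun r _ => hd r) (hc.intervalIntegrable s t),
    intervalIntegral.integral_same, neg_zero, Real.exp_zero]
  ring

section Piter

variable [MeasurableSpace E] {Q : ℝ → E → Measure E}

theorem Piter_congr {Q' : ℝ → E → Measure E} (h : ∀ t x, 0 ≤ t → Q t x = Q' t x) (n : ℕ) :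
    ∀ {s t : ℝ}, 0 ≤ s → s ≤ t → ∀ x, Piter Q n s t x = Piter Q' n s t x := by
  have hq {s t : ℝ} (hs : 0 ≤ s) (hst : s ≤ t) (x : E) :
      ∫ r in s..t, qIntensity Q r x = ∫ r in s..t, qIntensity Q' r x := by
    refine intervalIntegral.integral_congr fun r hr => ?_
    rw [uIcc_of_le hst] at hr
    simp only [qIntensity, h r x (hs.trans hr.1)]
  induction n with
  | zero => intro s t hs hst x; simp only [Piter, hq hs hst]
  | succ n ih =>
    intro s t hs hst x
    have hdens : (volume.restrict (Ioc s t)).withDensity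
          (fun r => ENNReal.ofReal (Real.exp (-∫ τ in s..r, qIntensity Q τ x))) =
        (volume.restrict (Ioc s t)).withDensity
          (fun r => ENNReal.ofReal (Real.exp (-∫ τ in s..r, qIntensity Q' τ x))) :=
      withDensity_congr_ae <| ae_restrict_of_forall_mem measurableSet_Ioc fun r hr => by
        simp only [hq hs hr.1.le]
    simp only [Piter, hdens]
    refine Measure.bind_congr_right <| (withDensity_absolutelyContinuous _ _).ae_le <|
      ae_restrict_of_forall_mem measurableSet_Ioc fun r hr => ?_
    have hr0 : 0 ≤ r := hs.trans hr.1.le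
    simp only [h r x hr0, fun y => ih hr0 hr.2 y]

theorem Piter_zero_apply_univ_le (s t : ℝ) (hst : s ≤ t) (x : E) : Piter Q 0 s t x univ ≤ 1 := by
  have : 0 ≤ ∫ r in s..t, qIntensity Q r x :=
    intervalIntegral.integral_nonneg hst fun r _ => ENNReal.toReal_nonneg
  simpa [Piter] using this

variable [TopologicalSpace E]

theorem continuous_qIntensity (hQ : WeaklyContinuous fun p : ℝ × E => Q p.1 p.2) :
    Continuous fun p : ℝ × E => qIntensity Q p.1 p.2 := by
  simpa [qIntensity, Measure.real] using hQ.2 (fun _ => 1) continuous_const ⟨1, by simp⟩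

theorem continuous_exp_neg_integral_qIntensity
    (hQ : WeaklyContinuous fun p : ℝ × E => Q p.1 p.2) :
    Continuous fun p : (ℝ × ℝ) × E =>
      Real.exp (-∫ r in p.1.1..p.1.2, qIntensity Q r p.2) := by
  refine Real.continuous_exp.comp (Continuous.neg ?_)
  refine Continuous.intervalIntegral_parametric
    (f := fun (p : (ℝ × ℝ) × E) r => qIntensity Q r p.2) ?_ (by fun_prop) (by fun_prop)
  exact (continuous_qIntensity hQ).comp (by fun_prop : Continuous fun z : ((ℝ × ℝ) × E) × ℝ =>
    (z.2, z.1.2))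

variable [BorelSpace E] [PolishSpace E] [LocallyCompactSpace E]

theorem Piter_weaklyContinuous (hQ : WeaklyContinuous fun p : ℝ × E => Q p.1 p.2) (n : ℕ) :
    (WeaklyContinuous fun p : (ℝ × ℝ) × E => Piter Q n p.1.1 (max p.1.1 p.1.2) p.2) ∧
      ∀ s t : ℝ, s ≤ t → ∀ x, Piter Q n s t x univ ≤ 1 := by
  have hQfin (r : ℝ) (x : E) : IsFiniteMeasure (Q r x) := hQ.1 (r, x)
  let _ := TopologicalSpace.upgradeIsCompletelyMetrizable E
  have hexp := continuous_exp_neg_integral_qIntensity hQ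
  have hfin_of_le {m : ℕ} (h : ∀ s t : ℝ, s ≤ t → ∀ x, Piter Q m s t x univ ≤ 1)
      (p : (ℝ × ℝ) × E) : IsFiniteMeasure (Piter Q m p.1.1 (max p.1.1 p.1.2) p.2) :=
    ⟨(h _ _ (le_max_left _ _) _).trans_lt ENNReal.one_lt_top⟩
  induction n with
  | zero =>
    refine ⟨⟨hfin_of_le Piter_zero_apply_univ_le, fun F hF _ => ?_⟩, Piter_zero_apply_univ_le⟩
    simp only [Piter, integral_smul_measure, integral_dirac,
      ENNReal.toReal_ofReal (Real.exp_pos _).le, smul_eq_mul]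
    exact (hexp.comp (by fun_prop : Continuous fun p : (ℝ × ℝ) × E =>
      ((p.1.1, max p.1.1 p.1.2), p.2))).mul (hF.comp continuous_snd)
  | succ n ih =>
    obtain ⟨ihc, ih1⟩ := ih
    let B : (ℝ × ℝ) × E → Measure E := fun p =>
      (Q p.1.1 p.2).bind fun y => Piter Q n p.1.1 (max p.1.1 p.1.2) y
    have hB : WeaklyContinuous B :=
      (hQ.comp (by fun_prop : Continuous fun p : (ℝ × ℝ) × E => (p.1.1, p.2))).bind
        (κ := fun p y => Piter Q n p.1.1 (max p.1.1 p.1.2) y)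
        (ihc.comp (by fun_prop : Continuous fun z : ((ℝ × ℝ) × E) × E => (z.1.1, z.2)))
        (fun p y => ih1 _ _ (le_max_left _ _) y)
    have hBq (p : (ℝ × ℝ) × E) : B p univ ≤ ENNReal.ofReal (qIntensity Q p.1.1 p.2) := by
      rw [qIntensity, ENNReal.ofReal_toReal (measure_ne_top _ _)]
      refine (Measure.bind_apply_le _ .univ).trans ?_
      exact (lintegral_mono fun y => ih1 _ _ (le_max_left _ _) y).trans (by simp)
    have hdens (s : ℝ) (x : E) : Continuous fun r =>
        Real.exp (-∫ τ in s..r, qIntensity Q τ x) :=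
      hexp.comp (by fun_prop : Continuous fun r : ℝ => ((s, r), x))
    have hBr (t : ℝ) (x : E) : WeaklyContinuous fun r => B ((r, t), x) :=
      hB.comp (by fun_prop : Continuous fun r : ℝ => ((r, t), x))
    have hsucc (s t : ℝ) (x : E) :
        Piter Q (n + 1) s t x = ((volume.restrict (Ioc s t)).withDensity fun r =>
          ENNReal.ofReal (Real.exp (-∫ τ in s..r, qIntensity Q τ x))).bind
            fun r => B ((r, t), x) := by
      refine Measure.bind_congr_right <| (withDensity_absolutelyContinuous _ _).ae_le <|
        ae_restrict_of_forall_mem measurableSet_Ioc fun r hr => ?_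
      simp only [B, max_eq_right hr.2]
    have hmass (s t : ℝ) (hst : s ≤ t) (x : E) : Piter Q (n + 1) s t x univ ≤ 1 := by
      have hq : Continuous fun r => qIntensity Q r x :=
        (continuous_qIntensity hQ).comp (.prodMk_left x)
      have hint : Integrable (fun r => Real.exp (-∫ τ in s..r, qIntensity Q τ x) *
          qIntensity Q r x) (volume.restrict (Ioc s t)) :=
        (((hdens s x).mul hq).intervalIntegrable s t).1
      have hBm : Measurable fun r => B ((r, t), x) univ :=
        (Measure.measurable_coe .univ).comp (hBr t x).measurable
      rw [hsucc, Measure.bind_apply .univ (hBr t x).measurable.aemeasurable,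
        lintegral_withDensity_eq_lintegral_mul _ (hdens s x).measurable.ennreal_ofReal hBm]
      calc _ ≤ ∫⁻ r in Ioc s t, ENNReal.ofReal
              (Real.exp (-∫ τ in s..r, qIntensity Q τ x) * qIntensity Q r x) := by
            refine lintegral_mono fun r => ?_
            rw [ENNReal.ofReal_mul (Real.exp_pos _).le]
            exact mul_le_mul_right (hBq ((r, t), x)) _
        _ = ENNReal.ofReal (1 - Real.exp (-∫ τ in s..t, qIntensity Q τ x)) := by
            rw [← ofReal_integral_eq_lintegral_ofReal hint (.of_forall fun r =>
              mul_nonneg (Real.exp_pos _).le ENNReal.toReal_nonneg),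
              ← intervalIntegral.integral_of_le hst, integral_exp_neg_integral_mul hq]
        _ ≤ 1 := by
            rw [ENNReal.ofReal_le_one]
            linarith [Real.exp_pos (-∫ τ in s..t, qIntensity Q τ x)]
    refine ⟨⟨hfin_of_le hmass, fun F hF hM => ?_⟩, hmass⟩
    have hintegral (p : (ℝ × ℝ) × E) :
        ∫ y, F y ∂(Piter Q (n + 1) p.1.1 (max p.1.1 p.1.2) p.2) =
          ∫ r in p.1.1..(max p.1.1 p.1.2), Real.exp (-∫ τ in p.1.1..r, qIntensity Q τ p.2) *
            ∫ y, F y ∂(B ((r, max p.1.1 p.1.2), p.2)) := by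
      have := hfin_of_le hmass p
      have hF' : Integrable F (Piter Q (n + 1) p.1.1 (max p.1.1 p.1.2) p.2) :=
        integrable_of_continuous_of_abs_le hF hM
      rw [hsucc] at hF' ⊢
      rw [integral_bind (hBr _ _).measurable.aemeasurable hF.measurable hF',
        integral_withDensity_eq_integral_toReal_smul (hdens _ _).measurable.ennreal_ofReal
          (.of_forall fun _ => ENNReal.ofReal_lt_top),
        intervalIntegral.integral_of_le (le_max_left _ _)]
      simp only [ENNReal.toReal_ofReal (Real.exp_pos _).le, smul_eq_mul]
    simp_rw [hintegral]
    refine Continuous.intervalIntegral_parametric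
      (f := fun (p : (ℝ × ℝ) × E) r => Real.exp (-∫ τ in p.1.1..r, qIntensity Q τ p.2) *
        ∫ y, F y ∂(B ((r, max p.1.1 p.1.2), p.2))) ?_ (by fun_prop) (by fun_prop)
    exact (hexp.comp (by fun_prop : Continuous fun z : ((ℝ × ℝ) × E) × ℝ =>
        ((z.1.1.1, z.2), z.1.2))).mul
      ((hB.2 F hF hM).comp (by fun_prop : Continuous fun z : ((ℝ × ℝ) × E) × ℝ =>
        ((z.2, max z.1.1.1 z.1.1.2), z.1.2)))

end Piter

/-- For a jointly weakly continuous transition function `Q`, every iterate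
`(s,t,x) ↦ U⁽ⁿ⁾(s,t)F(x) = ∫_E F(y) P⁽ⁿ⁾(s,x;t,dy)` is continuous on
`{(s,t) : 0 ≤ s ≤ t} × E` for bounded continuous `F`. -/
theorem iterates_are_feller [MeasurableSpace E] [TopologicalSpace E] [BorelSpace E]
    [PolishSpace E] [LocallyCompactSpace E]
    (Q : ℝ → E → Measure E) (hQ : IsTransitionFunction Q)
    (hw : JointlyWeaklyContinuous Q) :
    ∀ n : ℕ, ∀ F : E → ℝ, Continuous F → (∃ M : ℝ, ∀ x, |F x| ≤ M) →
      ContinuousOn (fun p : (ℝ × ℝ) × E => ∫ y, F y ∂(Piter Q n p.1.1 p.1.2 p.2))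
        {p : (ℝ × ℝ) × E | 0 ≤ p.1.1 ∧ p.1.1 ≤ p.1.2} := by
  intro n F hF hM
  let Q' : ℝ → E → Measure E := fun t x => Q (max t 0) x
  have hQ' : WeaklyContinuous fun p : ℝ × E => Q' p.1 p.2 :=
    ⟨fun p => hQ.1 _ _ (le_max_right _ _), fun G hG hGM =>
      (hw G hG hGM).comp_continuous
        (by fun_prop : Continuous fun p : ℝ × E => (max p.1 0, p.2)) fun p => le_max_right p.1 0⟩
  refine ((Piter_weaklyContinuous hQ' n).1.2 F hF hM).continuousOn.congr fun p hp => ?_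
  have hQQ' (t : ℝ) (x : E) (ht : 0 ≤ t) : Q t x = Q' t x := by simp only [Q', max_eq_left ht]
  simp only [max_eq_right hp.2, Piter_congr hQQ' n hp.1 hp.2]
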